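/- arXiv:1407.3096 — 2 statements merged into one kernel-verified Lean document; each statement's English description precedes it below -/
import Mathlib

section
/- Assume (f_i)_{i=1}^N satisfies the open set condition. Then for every k ≥ 1 and every σ ∈ Ω_k, μ(E_σ) = Σ_{h=0}^{k−1} p_0 · p_{σ|_h} · t_{σ^{(l)}_{−h}} + p_σ. -/
open MeasureTheory Filter

/-- The `n`-th quantization error of order `r` of a Borel measure `P` on `ℝ^q`:
the infimum of `(∫ d(x,α)^r dP)^{1/r}` over finite sets `α` with `1 ≤ card α ≤ n`. -/
noncomputable def quantErr {q : ℕ} (P : Measure (EuclideanSpace ℝ (Fin q)))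
    (n : ℕ) (r : ℝ) : ℝ :=
  sInf ((fun α : Finset (EuclideanSpace ℝ (Fin q)) =>
      (∫ x, Metric.infDist x (α : Set (EuclideanSpace ℝ (Fin q))) ^ r ∂P) ^ (1 / r)) ''
    {α : Finset (EuclideanSpace ℝ (Fin q)) | α.Nonempty ∧ α.card ≤ n})

/-- Product of weights `g` along a word `σ` (equals `1` for the empty word). -/
noncomputable def prodw {N : ℕ} (g : Fin N → ℝ) (σ : List (Fin N)) : ℝ := (σ.map g).prod

/-- The composition `f_{σ_1} ∘ ⋯ ∘ f_{σ_n}` along a word `σ`. -/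
def wordMap {q N : ℕ} (f : Fin N → EuclideanSpace ℝ (Fin q) → EuclideanSpace ℝ (Fin q))
    (σ : List (Fin N)) : EuclideanSpace ℝ (Fin q) → EuclideanSpace ℝ (Fin q) :=
  σ.foldr (fun i g => f i ∘ g) id

/-- `h(σ) = h^{(1)}(σ) + h^{(2)}(σ)` where
`h^{(1)}(σ) = Σ_{j=0}^{|σ|-1} p0 p_{σ|_j} t_{σ^{(l)}_{-j}} s_σ^r` and `h^{(2)}(σ) = p_σ s_σ^r`. -/
noncomputable def hfun {N : ℕ} (r p0 : ℝ) (s t p : Fin N → ℝ) (σ : List (Fin N)) : ℝ :=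
  (∑ j ∈ Finset.range σ.length, p0 * prodw p (σ.take j) * prodw t (σ.drop j)) * prodw s σ ^ r
    + prodw p σ * prodw s σ ^ r

/-- `η̲_r := min_{1 ≤ i ≤ N} min{p0 t_i + p_i, t_i} · s_i^r`. -/
noncomputable def etaLow {N : ℕ} (r p0 : ℝ) (s t p : Fin N → ℝ) : ℝ :=
  ⨅ i, min (p0 * t i + p i) (t i) * s i ^ r

/-- The finite maximal antichain `Λ_{k,r} = {σ : h(σ|_{|σ|-1}) ≥ η̲_r/k > h(σ)}`. -/
def Lam {N : ℕ} (r p0 : ℝ) (s t p : Fin N → ℝ) (k : ℕ) : Set (List (Fin N)) :=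
  {σ | σ ≠ [] ∧ etaLow r p0 s t p / k ≤ hfun r p0 s t p σ.dropLast ∧
    hfun r p0 s t p σ < etaLow r p0 s t p / k}

/-- `a(x) = Σ_i (t_i s_i^r)^{x/(x+r)}` (also used for `b` with `p` in place of `t`). -/
noncomputable def afun {N : ℕ} (r : ℝ) (s t : Fin N → ℝ) (x : ℝ) : ℝ :=
  ∑ i, (t i * s i ^ r) ^ (x / (x + r))

section Words

variable {q N : ℕ}

@[simp] lemma prodw_nil (g : Fin N → ℝ) : prodw g [] = 1 := by simp [prodw]

@[simp] lemma prodw_cons (g : Fin N → ℝ) (i : Fin N) (σ : List (Fin N)) :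
    prodw g (i :: σ) = g i * prodw g σ := by simp [prodw]

lemma prodw_append (g : Fin N → ℝ) (σ τ : List (Fin N)) :
    prodw g (σ ++ τ) = prodw g σ * prodw g τ := by simp [prodw]

lemma prodw_pos {g : Fin N → ℝ} (hg : ∀ i, 0 < g i) (σ : List (Fin N)) : 0 < prodw g σ := by
  induction σ with
  | nil => simp
  | cons i σ ih => simpa using mul_pos (hg i) ih

lemma prodw_le_one {g : Fin N → ℝ} (hg : ∀ i, g i ∈ Set.Ioo (0 : ℝ) 1) (σ : List (Fin N)) :
    prodw g σ ≤ 1 := by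
  induction σ with
  | nil => simp
  | cons i σ ih =>
    simpa using mul_le_one₀ (hg i).2.le (prodw_pos (fun i => (hg i).1) σ).le ih

lemma prodw_lt_one {g : Fin N → ℝ} (hg : ∀ i, g i ∈ Set.Ioo (0 : ℝ) 1) {σ : List (Fin N)}
    (hσ : σ ≠ []) : prodw g σ < 1 := by
  cases σ with
  | nil => exact absurd rfl hσ
  | cons i σ =>
    rw [prodw_cons]
    exact mul_lt_one_of_nonneg_of_lt_one_left (hg i).1.le (hg i).2 (prodw_le_one hg σ)

lemma prodw_le_of_isPrefix {g : Fin N → ℝ} (hg : ∀ i, g i ∈ Set.Ioo (0 : ℝ) 1)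
    {σ τ : List (Fin N)} (h : σ <+: τ) : prodw g τ ≤ prodw g σ := by
  obtain ⟨ρ, rfl⟩ := h
  rw [prodw_append]
  exact mul_le_of_le_one_right (prodw_pos (fun i => (hg i).1) σ).le (prodw_le_one hg ρ)

variable {f : Fin N → EuclideanSpace ℝ (Fin q) → EuclideanSpace ℝ (Fin q)}

@[simp] lemma wordMap_nil : wordMap f [] = id := rfl

@[simp] lemma wordMap_cons (i : Fin N) (σ : List (Fin N)) :
    wordMap f (i :: σ) = f i ∘ wordMap f σ := rfl

lemma wordMap_append (σ τ : List (Fin N)) :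
    wordMap f (σ ++ τ) = wordMap f σ ∘ wordMap f τ := by
  induction σ with
  | nil => rfl
  | cons i σ ih => simp [ih, Function.comp_assoc]

lemma wordMap_image_subset {A : Set (EuclideanSpace ℝ (Fin q))} (hA : ∀ i, f i '' A ⊆ A)
    (σ : List (Fin N)) : wordMap f σ '' A ⊆ A := by
  induction σ with
  | nil => simp
  | cons i σ ih =>
    rw [wordMap_cons, Set.image_comp]
    exact (Set.image_mono ih).trans (hA i)

lemma dist_wordMap {s : Fin N → ℝ} (hf : ∀ i x y, dist (f i x) (f i y) = s i * dist x y)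
    (σ : List (Fin N)) (x y : EuclideanSpace ℝ (Fin q)) :
    dist (wordMap f σ x) (wordMap f σ y) = prodw s σ * dist x y := by
  induction σ with
  | nil => simp
  | cons i σ ih => simp [hf, ih, mul_assoc]

lemma injective_wordMap (hf : ∀ i, Function.Injective (f i)) (σ : List (Fin N)) :
    Function.Injective (wordMap f σ) := by
  induction σ with
  | nil => exact Function.injective_id
  | cons i σ ih => exact (hf i).comp ih

lemma surjective_wordMap (hf : ∀ i, Function.Surjective (f i)) (σ : List (Fin N)) :
    Function.Surjective (wordMap f σ) := by
  induction σ with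
  | nil => exact Function.surjective_id
  | cons i σ ih => exact (hf i).comp ih

lemma continuous_wordMap (hf : ∀ i, Continuous (f i)) (σ : List (Fin N)) :
    Continuous (wordMap f σ) := by
  induction σ with
  | nil => exact continuous_id
  | cons i σ ih => exact (hf i).comp ih

/-- Under the open set condition, incomparable words give disjoint images of the open set. -/
lemma disjoint_wordMap_image (hinj : ∀ i, Function.Injective (f i))
    {U : Set (EuclideanSpace ℝ (Fin q))} (hU : ∀ i, f i '' U ⊆ U)
    (hdisj : Pairwise fun i j => Disjoint (f i '' U) (f j '' U)) {σ τ : List (Fin N)}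
    (h1 : ¬ σ <+: τ) (h2 : ¬ τ <+: σ) : Disjoint (wordMap f σ '' U) (wordMap f τ '' U) := by
  induction σ generalizing τ with
  | nil => simp at h1
  | cons i σ ih =>
    cases τ with
    | nil => simp at h2
    | cons j τ =>
      simp only [wordMap_cons, Set.image_comp]
      by_cases hij : i = j
      · subst hij
        rw [Set.disjoint_image_iff (hinj i)]
        exact ih (by simpa using h1) (by simpa using h2)
      · exact (hdisj hij).mono (Set.image_mono (wordMap_image_subset hU σ))
          (Set.image_mono (wordMap_image_subset hU τ))

end Words

section Similitudes

lemma injective_of_dist_eq_mul {X : Type*} [MetricSpace X] {g : X → X} {c : ℝ} (hc : 0 < c)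
    (hg : ∀ x y, dist (g x) (g y) = c * dist x y) : Function.Injective g := by
  intro x y h
  have := hg x y
  rw [h, dist_self] at this
  have : dist x y = 0 := by
    rcases mul_eq_zero.1 this.symm with h | h
    · exact absurd h hc.ne'
    · exact h
  exact dist_eq_zero.1 this

lemma continuous_of_dist_eq_mul {X : Type*} [PseudoMetricSpace X] {g : X → X} {c : ℝ}
    (hg : ∀ x y, dist (g x) (g y) = c * dist x y) : Continuous g := by
  refine (LipschitzWith.of_dist_le_mul (K := c.toNNReal) fun x y => ?_).continuous
  rw [hg]
  exact mul_le_mul_of_nonneg_right (Real.le_coe_toNNReal c) dist_nonneg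

lemma surjective_of_dist_eq_mul {V : Type*} [NormedAddCommGroup V] [InnerProductSpace ℝ V]
    [FiniteDimensional ℝ V] {g : V → V} {c : ℝ} (hc : 0 < c)
    (hg : ∀ x y, dist (g x) (g y) = c * dist x y) : Function.Surjective g := by
  have hiso : Isometry fun x => c⁻¹ • g x := by
    refine Isometry.of_dist_eq fun x y => ?_
    rw [dist_smul₀, hg, Real.norm_of_nonneg (inv_nonneg.2 hc.le), inv_mul_cancel_left₀ hc.ne']
  let A := hiso.affineIsometryOfStrictConvexSpace
  have hA : Function.Surjective A := by
    have : Inhabited V := ⟨0⟩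
    exact (A.toAffineIsometryEquiv rfl).surjective
  intro y
  obtain ⟨x, hx⟩ := hA (c⁻¹ • y)
  refine ⟨x, ?_⟩
  have hx' : c⁻¹ • g x = c⁻¹ • y := hx
  exact smul_right_injective V (inv_ne_zero hc.ne') hx'

/-- Separated subsets of a totally bounded set have uniformly bounded cardinality. -/
lemma TotallyBounded.exists_card_le_of_separated {X : Type*} [PseudoMetricSpace X] {B : Set X}
    (hB : TotallyBounded B) {δ : ℝ} (hδ : 0 < δ) :
    ∃ M : ℕ, ∀ S : Set X, S ⊆ B → (S.Pairwise fun x y => δ ≤ dist x y) →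
      S.Finite ∧ S.ncard ≤ M := by
  obtain ⟨T, hT, hcov⟩ := Metric.totallyBounded_iff.1 hB (δ / 2) (half_pos hδ)
  refine ⟨T.ncard, fun S hS hsep => ?_⟩
  have hex : ∀ x ∈ S, ∃ y ∈ T, dist x y < δ / 2 := fun x hx => by
    simpa using hcov (hS hx)
  choose! g hgT hg using hex
  have hinj : Set.InjOn g S := by
    intro x hx y hy hxy
    by_contra hne
    have h1 := hsep hx hy hne
    have h2 := hg x hx
    have h3 := hg y hy
    rw [← hxy] at h3
    linarith [dist_triangle_right x y (g x)]
  exact ⟨Set.Finite.of_injOn hgT hinj hT, Set.ncard_le_ncard_of_injOn g hgT hinj hT⟩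

end Similitudes

section Neighbours

variable {q N : ℕ} {f : Fin N → EuclideanSpace ℝ (Fin q) → EuclideanSpace ℝ (Fin q)}
  {s : Fin N → ℝ} {E : Set (EuclideanSpace ℝ (Fin q))}

/-- The words `τ` with ratio comparable to that of `σ` and with `f_τ(E)` meeting `f_σ(E)`. -/
def neighbours (f : Fin N → EuclideanSpace ℝ (Fin q) → EuclideanSpace ℝ (Fin q))
    (s : Fin N → ℝ) (E : Set (EuclideanSpace ℝ (Fin q))) (σ : List (Fin N)) :
    Set (List (Fin N)) :=
  {τ | τ ≠ [] ∧ prodw s τ ≤ prodw s σ ∧ prodw s σ < prodw s τ.dropLast ∧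
    (wordMap f τ '' E ∩ wordMap f σ '' E).Nonempty}

lemma not_prefix_of_prodw_lt_dropLast (hs : ∀ i, s i ∈ Set.Ioo (0 : ℝ) 1) {b : ℝ}
    {σ τ : List (Fin N)} (hne : σ ≠ τ) (hσ : prodw s σ ≤ b) (hτ0 : τ ≠ [])
    (hτ : b < prodw s τ.dropLast) : ¬ σ <+: τ := by
  intro h
  rw [← List.dropLast_concat_getLast hτ0, List.prefix_concat_iff,
    List.dropLast_concat_getLast hτ0] at h
  rcases h with h | h
  · exact hne h
  · exact absurd (prodw_le_of_isPrefix hs h) (by linarith)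

/-- The open set condition bounds the number of neighbours. -/
lemma exists_ncard_neighbours_le [Nonempty (Fin N)] (hs : ∀ i, s i ∈ Set.Ioo (0 : ℝ) 1)
    (hf : ∀ i x y, dist (f i x) (f i y) = s i * dist x y) (hE : Bornology.IsBounded E)
    {U : Set (EuclideanSpace ℝ (Fin q))} (hUne : U.Nonempty) (hUo : IsOpen U)
    (hU : ∀ i, f i '' U ⊆ U) (hdisj : Pairwise fun i j => Disjoint (f i '' U) (f j '' U)) :
    ∃ M : ℕ, ∀ σ, (neighbours f s E σ).Finite ∧ (neighbours f s E σ).ncard ≤ M := by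
  obtain ⟨u, hu⟩ := hUne
  obtain ⟨ρ, hρ, hball⟩ := Metric.isOpen_iff.1 hUo u hu
  obtain ⟨D, hD⟩ := hE.subset_closedBall u
  obtain ⟨k, hk⟩ := Finite.exists_min s
  obtain ⟨M, hM⟩ := (isCompact_closedBall (0 : EuclideanSpace ℝ (Fin q)) (2 * D)).totallyBounded
    |>.exists_card_le_of_separated (mul_pos (hs k).1 hρ)
  have hs0 : ∀ i, 0 < s i := fun i => (hs i).1
  have hinj : ∀ i, Function.Injective (f i) := fun i => injective_of_dist_eq_mul (hs0 i) (hf i)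
  have hsurj : ∀ i, Function.Surjective (f i) := fun i =>
    surjective_of_dist_eq_mul (hs0 i) (hf i)
  refine ⟨M, fun σ => ?_⟩
  have hb := prodw_pos hs0 σ
  set b := prodw s σ with hbdef
  let g : List (Fin N) → EuclideanSpace ℝ (Fin q) :=
    fun τ => b⁻¹ • (wordMap f τ u - wordMap f σ u)
  have hgdist : ∀ τ τ', dist (g τ) (g τ') = b⁻¹ * dist (wordMap f τ u) (wordMap f τ' u) := by
    intro τ τ'
    simp only [g]
    rw [dist_smul₀, dist_sub_right, Real.norm_of_nonneg (inv_nonneg.2 hb.le)]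
  have hsep : ∀ τ ∈ neighbours f s E σ, ∀ τ' ∈ neighbours f s E σ, τ ≠ τ' →
      s k * ρ ≤ dist (g τ) (g τ') := by
    rintro τ ⟨hτ0, hτ1, hτ2, -⟩ τ' ⟨hτ'0, hτ'1, hτ'2, -⟩ hne
    have hd := disjoint_wordMap_image hinj hU hdisj
      (not_prefix_of_prodw_lt_dropLast hs hne hτ1 hτ'0 hτ'2)
      (not_prefix_of_prodw_lt_dropLast hs hne.symm hτ'1 hτ0 hτ2)
    obtain ⟨v, hv⟩ := surjective_wordMap hsurj τ (wordMap f τ' u)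
    have hvU : v ∉ U := fun hvU =>
      Set.disjoint_left.1 hd ⟨v, hvU, rfl⟩ ⟨u, hu, hv.symm⟩
    have hρv : ρ ≤ dist u v := by
      by_contra! h
      exact hvU (hball (by rwa [Metric.mem_ball, dist_comm]))
    have hτs : s k * b ≤ prodw s τ := by
      rw [← List.dropLast_concat_getLast hτ0, prodw_append, prodw_cons, prodw_nil, mul_one,
        mul_comm]
      exact mul_le_mul hτ2.le (hk _) (hs0 k).le (prodw_pos hs0 _).le
    rw [hgdist, ← hv, dist_wordMap hf]
    calc s k * ρ = b⁻¹ * (s k * b * ρ) := by field_simp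
      _ ≤ _ := by have := (prodw_pos hs0 τ).le; gcongr
  have hmaps : g '' neighbours f s E σ ⊆ Metric.closedBall 0 (2 * D) := by
    rintro _ ⟨τ, ⟨-, hτ1, -, y, ⟨e, he, hey⟩, ⟨e', he', hey'⟩⟩, rfl⟩
    have h0 : g σ = 0 := by simp [g]
    rw [Metric.mem_closedBall, ← h0, hgdist, inv_mul_le_iff₀ hb]
    have hD1 : dist u e ≤ D := by rw [dist_comm]; exact hD he
    have hD2 : dist e' u ≤ D := hD he'
    have h1 : dist (wordMap f τ u) y ≤ b * D := by
      rw [← hey, dist_wordMap hf]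
      exact mul_le_mul hτ1 hD1 dist_nonneg hb.le
    have h2 : dist y (wordMap f σ u) ≤ b * D := by
      rw [← hey', dist_wordMap hf]
      gcongr
    linarith [dist_triangle (wordMap f τ u) y (wordMap f σ u)]
  have hginj : Set.InjOn g (neighbours f s E σ) := by
    intro τ hτ τ' hτ' h
    by_contra hne
    have := hsep τ hτ τ' hτ' hne
    rw [h, dist_self] at this
    exact absurd (mul_pos (hs0 k) hρ) (not_lt.2 this)
  obtain ⟨hfin, hcard⟩ := hM _ hmaps (by
    rintro _ ⟨τ, hτ, rfl⟩ _ ⟨τ', hτ', rfl⟩ hne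
    exact hsep τ hτ τ' hτ' fun h => hne (by rw [h]))
  exact ⟨hfin.of_finite_image hginj, by rwa [hginj.ncard_image] at hcard⟩

lemma exists_prefix_mem_wordMap_image [Nonempty (Fin N)] (hs : ∀ i, s i ∈ Set.Ioo (0 : ℝ) 1)
    (hE : E = ⋃ i, f i '' E) {b : ℝ} (hb : 0 < b) {ω : List (Fin N)} (hω : ω ≠ [])
    (hωb : b < prodw s ω.dropLast) {x : EuclideanSpace ℝ (Fin q)} (hx : x ∈ wordMap f ω '' E) :
    ∃ τ, ω <+: τ ∧ prodw s τ ≤ b ∧ b < prodw s τ.dropLast ∧ x ∈ wordMap f τ '' E := by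
  obtain ⟨k, hk⟩ := Finite.exists_max s
  obtain ⟨n, hn⟩ := exists_pow_lt_of_lt_one hb (hs k).2
  have hs0 : ∀ i, 0 < s i := fun i => (hs i).1
  have key : ∀ n (ω : List (Fin N)), ω ≠ [] → b < prodw s ω.dropLast → x ∈ wordMap f ω '' E →
      prodw s ω * s k ^ n ≤ b →
      ∃ τ, ω <+: τ ∧ prodw s τ ≤ b ∧ b < prodw s τ.dropLast ∧ x ∈ wordMap f τ '' E := by
    intro n
    induction n with
    | zero => exact fun ω _ h1 h2 h3 => ⟨ω, List.prefix_rfl, by simpa using h3, h1, h2⟩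
    | succ n ih =>
      intro ω h0 h1 h2 h3
      by_cases hle : prodw s ω ≤ b
      · exact ⟨ω, List.prefix_rfl, hle, h1, h2⟩
      obtain ⟨e, he, rfl⟩ := h2
      rw [hE] at he
      obtain ⟨i, e', he', rfl⟩ := Set.mem_iUnion.1 he
      obtain ⟨τ, hτ, hrest⟩ := ih (ω ++ [i]) (by simp) (by simpa using hle)
        ⟨e', he', by simp [wordMap_append]⟩ (by
          refine le_trans ?_ h3
          rw [prodw_append, prodw_cons, prodw_nil, mul_one, pow_succ', mul_assoc]
          have := (prodw_pos hs0 ω).le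
          have := (pow_pos (hs0 k) n).le
          gcongr
          exact hk i)
      exact ⟨τ, (List.prefix_append ω [i]).trans hτ, hrest⟩
  exact key n ω hω hωb hx
    ((mul_le_of_le_one_left (pow_pos (hs0 k) n).le (prodw_le_one hs ω)).trans hn.le)

/-- Under the open set condition, some word `σ` is such that the pieces `f_{iωσ}(E)` avoid all
first-level pieces `f_j(E)` with `j ≠ i`. -/
lemma exists_word_disjoint_pieces [Nonempty (Fin N)] (hs : ∀ i, s i ∈ Set.Ioo (0 : ℝ) 1)
    (hf : ∀ i x y, dist (f i x) (f i y) = s i * dist x y) (hEb : Bornology.IsBounded E)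
    (hE : E = ⋃ i, f i '' E)
    {U : Set (EuclideanSpace ℝ (Fin q))} (hUne : U.Nonempty) (hUo : IsOpen U)
    (hU : ∀ i, f i '' U ⊆ U) (hdisj : Pairwise fun i j => Disjoint (f i '' U) (f j '' U)) :
    ∃ σ : List (Fin N), ∀ i j, i ≠ j → ∀ ω,
      Disjoint (wordMap f (i :: (ω ++ σ)) '' E) (f j '' E) := by
  obtain ⟨M, hM⟩ := exists_ncard_neighbours_le hs hf hEb hUne hUo hU hdisj
  have hs0 : ∀ i, 0 < s i := fun i => (hs i).1
  have hbdd : BddAbove ((fun σ => (neighbours f s E σ).ncard) '' {σ | σ ≠ []}) :=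
    ⟨M, by rintro _ ⟨σ, -, rfl⟩; exact (hM σ).2⟩
  have hne : ((fun σ => (neighbours f s E σ).ncard) '' {σ | σ ≠ []}).Nonempty :=
    ⟨_, [Classical.arbitrary _], by simp, rfl⟩
  obtain ⟨σ, hσ0, hσ⟩ := Nat.sSup_mem hne hbdd
  have hmax : ∀ τ, τ ≠ [] → (neighbours f s E τ).ncard ≤ (neighbours f s E σ).ncard :=
    fun τ hτ => (le_csSup hbdd ⟨τ, hτ, rfl⟩).trans hσ.ge
  refine ⟨σ, fun i j hij ω => Set.disjoint_left.2 fun x hx hxj => ?_⟩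
  rw [← List.cons_append] at hx
  have hsub : ((i :: ω) ++ ·) '' neighbours f s E σ ⊆ neighbours f s E ((i :: ω) ++ σ) := by
    rintro _ ⟨τ, ⟨h0, h1, h2, h3⟩, rfl⟩
    have hp := prodw_pos hs0 (i :: ω)
    refine ⟨by simp, ?_, ?_, ?_⟩
    · rw [prodw_append, prodw_append]
      gcongr
    · rw [List.dropLast_append_of_ne_nil h0, prodw_append, prodw_append]
      gcongr
    · obtain ⟨y, hy, hy'⟩ := h3
      rw [wordMap_append, wordMap_append, Set.image_comp, Set.image_comp]
      exact ⟨_, Set.mem_image_of_mem _ hy, Set.mem_image_of_mem _ hy'⟩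
  have heq := Set.eq_of_subset_of_ncard_le hsub (by
    rw [Set.ncard_image_of_injective _ (List.append_right_injective (i :: ω))]
    exact hmax _ (by simp)) (hM _).1
  obtain ⟨τ, hτ1, hτ2, hτ3, hτ4⟩ := exists_prefix_mem_wordMap_image hs hE
    (prodw_pos hs0 ((i :: ω) ++ σ)) (ω := [j]) (by simp)
    (by simpa using prodw_lt_one hs (σ := (i :: ω) ++ σ) (by simp)) (x := x) (by simpa using hxj)
  have hmem : τ ∈ neighbours f s E ((i :: ω) ++ σ) := by
    refine ⟨?_, hτ2, hτ3, x, hτ4, hx⟩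
    rintro rfl
    simp at hτ1
  rw [← heq] at hmem
  obtain ⟨τ', -, rfl⟩ := hmem
  have := List.cons_prefix_cons.1 hτ1
  exact hij this.1.symm

end Neighbours

section Measures

open Measure

variable {q N : ℕ} {f : Fin N → EuclideanSpace ℝ (Fin q) → EuclideanSpace ℝ (Fin q)}
  {E : Set (EuclideanSpace ℝ (Fin q))} {t p : Fin N → ℝ} {p0 : ℝ}
  {ν μ : Measure (EuclideanSpace ℝ (Fin q))}

lemma selfSimilar_apply (hfm : ∀ i, Measurable (f i))
    (hν : ν = ∑ i, ENNReal.ofReal (t i) • ν.map (f i)) {A : Set (EuclideanSpace ℝ (Fin q))}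
    (hA : MeasurableSet A) : ν A = ∑ i, ENNReal.ofReal (t i) * ν (f i ⁻¹' A) := by
  conv_lhs => rw [hν]
  simp [Measure.finsetSum_apply, Measure.map_apply (hfm _) hA]

lemma inhomSelfSimilar_apply (hfm : ∀ i, Measurable (f i))
    (hμ : μ = ENNReal.ofReal p0 • ν + ∑ i, ENNReal.ofReal (p i) • μ.map (f i))
    {A : Set (EuclideanSpace ℝ (Fin q))} (hA : MeasurableSet A) :
    μ A = ENNReal.ofReal p0 * ν A + ∑ i, ENNReal.ofReal (p i) * μ (f i ⁻¹' A) := by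
  conv_lhs => rw [hμ]
  simp [Measure.map_apply (hfm _) hA]

lemma quasiMeasurePreserving_of_selfSimilar (hfm : ∀ i, Measurable (f i)) (ht : ∀ i, 0 < t i)
    (hν : ν = ∑ i, ENNReal.ofReal (t i) • ν.map (f i)) (i : Fin N) :
    QuasiMeasurePreserving (f i) ν ν := by
  refine ⟨hfm i, AbsolutelyContinuous.mk fun A hA h0 => ?_⟩
  rw [Measure.map_apply (hfm i) hA]
  rw [selfSimilar_apply hfm hν hA, Finset.sum_eq_zero_iff] at h0
  have := h0 i (Finset.mem_univ i)
  simpa [(ht i).not_ge] using this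

lemma quasiMeasurePreserving_wordMap (hq : ∀ i, QuasiMeasurePreserving (f i) ν ν)
    (σ : List (Fin N)) : QuasiMeasurePreserving (wordMap f σ) ν ν := by
  induction σ with
  | nil => exact QuasiMeasurePreserving.id ν
  | cons i σ ih => exact (hq i).comp ih

/-- A backward invariant set is almost everywhere equal to its preimages. -/
lemma preimage_wordMap_ae_eq [IsFiniteMeasure ν] (hfm : ∀ i, Measurable (f i))
    (ht : ∀ i, 0 < t i) (ht1 : ∑ i, t i = 1)
    (hν : ν = ∑ i, ENNReal.ofReal (t i) • ν.map (f i)) {A : Set (EuclideanSpace ℝ (Fin q))}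
    (hA : MeasurableSet A) (hinv : ∀ i, f i ⁻¹' A ⊆ A) (σ : List (Fin N)) :
    wordMap f σ ⁻¹' A =ᵐ[ν] A := by
  have hq := quasiMeasurePreserving_of_selfSimilar hfm ht hν
  have h1 : ∀ i, f i ⁻¹' A =ᵐ[ν] A := by
    intro i
    refine ae_eq_of_subset_of_measure_ge (hinv i) ?_ (hfm i hA).nullMeasurableSet
      (measure_ne_top ν A)
    by_contra! hlt
    have hsum : ∑ j, ENNReal.ofReal (t j) * ν A = ν A := by
      rw [← Finset.sum_mul, ← ENNReal.ofReal_sum_of_nonneg fun j _ => (ht j).le, ht1]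
      simp
    have : ∑ j, ENNReal.ofReal (t j) * ν (f j ⁻¹' A) < ∑ j, ENNReal.ofReal (t j) * ν A := by
      rw [← Finset.add_sum_erase _ _ (Finset.mem_univ i),
        ← Finset.add_sum_erase _ (fun j => ENNReal.ofReal (t j) * ν A) (Finset.mem_univ i)]
      refine ENNReal.add_lt_add_of_lt_of_le ?_ ?_ ?_
      · exact ENNReal.sum_ne_top.2 fun j _ => ENNReal.mul_ne_top ENNReal.ofReal_ne_top
          (measure_ne_top _ _)
      · exact ENNReal.mul_lt_mul_right (by simpa using ht i) ENNReal.ofReal_ne_top hlt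
      · gcongr with j
        exact hinv j
    rw [hsum, ← selfSimilar_apply hfm hν hA] at this
    exact this.false
  induction σ with
  | nil => rfl
  | cons i σ ih =>
    exact ((quasiMeasurePreserving_wordMap hq σ).preimage_ae_eq (h1 i)).trans ih

/-- A compactly supported self-similar measure is carried by the self-similar set. -/
lemma measure_compl_eq_zero_of_selfSimilar [Nonempty (Fin N)] {s : Fin N → ℝ}
    (hs : ∀ i, s i ∈ Set.Ioo (0 : ℝ) 1) (hf : ∀ i x y, dist (f i x) (f i y) = s i * dist x y)
    (hEc : IsClosed E) (hEne : E.Nonempty) (hE : ∀ i, f i '' E ⊆ E)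
    (hK : ∃ K, IsCompact K ∧ ν Kᶜ = 0)
    (hν : ν = ∑ i, ENNReal.ofReal (t i) • ν.map (f i)) : ν Eᶜ = 0 := by
  have hfm : ∀ i, Measurable (f i) := fun i => (continuous_of_dist_eq_mul (hf i)).measurable
  obtain ⟨K, hK, hK0⟩ := hK
  obtain ⟨k, hk⟩ := Finite.exists_max s
  obtain ⟨R, hR⟩ := (hK.image (Metric.continuous_infDist_pt E)).bddAbove
  let c := s k
  have hc : 0 < c := (hs k).1
  have hinf : ∀ i x, Metric.infDist (f i x) E ≤ c * Metric.infDist x E := by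
    intro i x
    obtain ⟨e, he, hd⟩ := hEc.exists_infDist_eq_dist hEne x
    calc Metric.infDist (f i x) E ≤ dist (f i x) (f i e) :=
          Metric.infDist_le_dist_of_mem (hE i ⟨e, he, rfl⟩)
      _ = s i * dist x e := hf i x e
      _ ≤ c * Metric.infDist x E := by rw [hd]; gcongr; exact hk i
  let A : ℝ → Set (EuclideanSpace ℝ (Fin q)) := fun r => {x | r < Metric.infDist x E}
  have hA : ∀ r, MeasurableSet (A r) := fun r =>
    (isOpen_lt continuous_const (Metric.continuous_infDist_pt E)).measurableSet
  have hbig : ν (A R) = 0 := by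
    refine measure_mono_null (t := Kᶜ) (fun x hx hxK => ?_) hK0
    exact absurd (hR ⟨x, hxK, rfl⟩) (not_le.2 hx)
  have hpow : ∀ n : ℕ, ν (A (c ^ n * R)) = 0 := by
    intro n
    induction n with
    | zero => simpa using hbig
    | succ n ih =>
      rw [selfSimilar_apply hfm hν (hA _)]
      refine Finset.sum_eq_zero fun i _ => ?_
      rw [measure_mono_null (t := A (c ^ n * R)) ?_ ih, mul_zero]
      intro x hx
      have h1 : c ^ (n + 1) * R < c * Metric.infDist x E := lt_of_lt_of_le hx (hinf i x)
      rw [pow_succ', mul_assoc] at h1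
      exact lt_of_mul_lt_mul_left h1 hc.le
  refine measure_mono_null (t := ⋃ n : ℕ, A (c ^ n * R)) (fun x hx => ?_)
    (measure_iUnion_null hpow)
  have hpos : 0 < Metric.infDist x E := (hEc.notMem_iff_infDist_pos hEne).1 hx
  have hlim : Tendsto (fun n : ℕ => c ^ n * R) atTop (nhds 0) := by
    simpa using (tendsto_pow_atTop_nhds_zero_of_lt_one hc.le (hs k).2).mul_const R
  obtain ⟨n, hn⟩ := (hlim.eventually (gt_mem_nhds hpos)).exists
  exact Set.mem_iUnion.2 ⟨n, hn⟩

/-- An in-homogeneous self-similar measure is absolutely continuous with respect to `ν`. -/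
lemma absolutelyContinuous_of_inhomSelfSimilar [IsProbabilityMeasure μ]
    (hq : ∀ i, QuasiMeasurePreserving (f i) ν ν) (hp0 : 0 < p0) (hp : ∀ i, 0 < p i)
    (hp1 : p0 + ∑ i, p i = 1)
    (hμ : μ = ENNReal.ofReal p0 • ν + ∑ i, ENNReal.ofReal (p i) • μ.map (f i)) : μ ≪ ν := by
  have hfm : ∀ i, Measurable (f i) := fun i => (hq i).measurable
  have hsum : ∑ i, ENNReal.ofReal (p i) = ENNReal.ofReal (1 - p0) := by
    rw [← ENNReal.ofReal_sum_of_nonneg fun j _ => (hp j).le, ← hp1]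
    simp
  have key : ∀ (n : ℕ) (A : Set (EuclideanSpace ℝ (Fin q))), MeasurableSet A → ν A = 0 →
      μ A ≤ ENNReal.ofReal (1 - p0) ^ n := by
    intro n
    induction n with
    | zero => exact fun A _ _ => by simpa using prob_le_one
    | succ n ih =>
      intro A hA h0
      rw [inhomSelfSimilar_apply hfm hμ hA, h0, mul_zero, zero_add, pow_succ', ← hsum,
        Finset.sum_mul, hsum]
      gcongr with i
      exact ih _ (hfm i hA) ((hq i).preimage_null h0)
  refine AbsolutelyContinuous.mk fun A hA h0 => ?_
  have hlim := ENNReal.tendsto_pow_atTop_nhds_zero_of_lt_one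
    (r := ENNReal.ofReal (1 - p0)) (by rw [ENNReal.ofReal_lt_one]; linarith)
  exact le_antisymm (ge_of_tendsto' hlim fun n => key n A hA h0) zero_le

end Measures

/-- Lemma (Zhu): under the OSC, for every non-empty word `σ` of length `k`,
`μ(E_σ) = Σ_{h=0}^{k-1} p_0 p_{σ|_h} t_{σ^{(l)}_{-h}} + p_σ`. -/
theorem measure_cylinder_formula
    (q N : ℕ) (hq : 1 ≤ q) (hN : 2 ≤ N) (r : ℝ) (hr : 0 < r)
    (f : Fin N → EuclideanSpace ℝ (Fin q) → EuclideanSpace ℝ (Fin q))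
    (s : Fin N → ℝ) (hs : ∀ i, s i ∈ Set.Ioo (0 : ℝ) 1)
    (hf : ∀ i x y, dist (f i x) (f i y) = s i * dist x y)
    (E : Set (EuclideanSpace ℝ (Fin q)))
    (hEcpt : IsCompact E) (hEne : E.Nonempty) (hEss : E = ⋃ i, f i '' E)
    (hEdiam : Metric.diam E = 1)
    (hOSC : ∃ U : Set (EuclideanSpace ℝ (Fin q)), U.Nonempty ∧ IsOpen U ∧
      (∀ i, f i '' U ⊆ U) ∧ Pairwise fun i j => Disjoint (f i '' U) (f j '' U))
    (t : Fin N → ℝ) (ht : ∀ i, 0 < t i) (ht1 : ∑ i, t i = 1)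
    (ν : Measure (EuclideanSpace ℝ (Fin q))) (hνP : IsProbabilityMeasure ν)
    (hνc : ∃ K, IsCompact K ∧ ν Kᶜ = 0)
    (hνss : ν = ∑ i, ENNReal.ofReal (t i) • ν.map (f i))
    (p0 : ℝ) (p : Fin N → ℝ) (hp0 : 0 < p0) (hp : ∀ i, 0 < p i)
    (hp1 : p0 + ∑ i, p i = 1)
    (μ : Measure (EuclideanSpace ℝ (Fin q))) (hμP : IsProbabilityMeasure μ)
    (hμc : ∃ K, IsCompact K ∧ μ Kᶜ = 0)
    (hμss : μ = ENNReal.ofReal p0 • ν + ∑ i, ENNReal.ofReal (p i) • μ.map (f i))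
    :
    ∀ σ : List (Fin N), σ ≠ [] →
      μ (wordMap f σ '' E) = ENNReal.ofReal
        (∑ j ∈ Finset.range σ.length, p0 * prodw p (σ.take j) * prodw t (σ.drop j)
          + prodw p σ) := by
  have : Nonempty (Fin N) := ⟨⟨0, by omega⟩⟩
  have hs0 : ∀ i, 0 < s i := fun i => (hs i).1
  have hinj : ∀ i, Function.Injective (f i) := fun i => injective_of_dist_eq_mul (hs0 i) (hf i)
  have hfc : ∀ i, Continuous (f i) := fun i => continuous_of_dist_eq_mul (hf i)
  have hfm : ∀ i, Measurable (f i) := fun i => (hfc i).measurable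
  have hEsub : ∀ i, f i '' E ⊆ E := fun i => by
    conv_rhs => rw [hEss]
    exact Set.subset_iUnion (fun i => f i '' E) i
  have hEm : ∀ σ, MeasurableSet (wordMap f σ '' E) := fun σ =>
    (hEcpt.image (continuous_wordMap hfc σ)).measurableSet
  have hquasi := quasiMeasurePreserving_of_selfSimilar hfm ht hνss
  have hac := absolutelyContinuous_of_inhomSelfSimilar hquasi hp0 hp hp1 hμss
  have hνE : ν Eᶜ = 0 := measure_compl_eq_zero_of_selfSimilar hs hf hEcpt.isClosed hEne hEsub
    hνc hνss
  obtain ⟨U, hUne, hUo, hU, hdisj⟩ := hOSC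
  obtain ⟨σ₀, hσ₀⟩ := exists_word_disjoint_pieces hs hf hEcpt.isBounded hEss hUne hUo hU hdisj
  let G : Set (EuclideanSpace ℝ (Fin q)) := ⋃ ω : List (Fin N), wordMap f (ω ++ σ₀) '' E
  have hG : ν Gᶜ = 0 := by
    have hGm : MeasurableSet Gᶜ := (MeasurableSet.iUnion fun ω => hEm (ω ++ σ₀)).compl
    have hinv : ∀ i, f i ⁻¹' Gᶜ ⊆ Gᶜ := by
      intro i x hx hxG
      obtain ⟨ω, e, he, rfl⟩ := Set.mem_iUnion.1 hxG
      exact hx (Set.mem_iUnion.2 ⟨i :: ω, e, he, rfl⟩)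
    rw [← measure_congr (preimage_wordMap_ae_eq hfm ht ht1 hνss hGm hinv σ₀)]
    refine measure_mono_null (t := Eᶜ) (fun x hx hxE => ?_) hνE
    exact hx (Set.mem_iUnion.2 ⟨[], x, hxE, rfl⟩)
  have hoverlap : ∀ i j, i ≠ j → ν (f i ⁻¹' (f j '' E)) = 0 := by
    intro i j hij
    refine measure_mono_null (t := Gᶜ) (fun x hx hxG => ?_) hG
    obtain ⟨ω, e, he, rfl⟩ := Set.mem_iUnion.1 hxG
    exact Set.disjoint_left.1 (hσ₀ i j hij ω) ⟨e, he, rfl⟩ hx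
  have hnull : ∀ i j σ, i ≠ j → ν (f i ⁻¹' (wordMap f (j :: σ) '' E)) = 0 := by
    intro i j σ hij
    refine measure_mono_null (Set.preimage_mono ?_) (hoverlap i j hij)
    rw [wordMap_cons, Set.image_comp]
    exact Set.image_mono (wordMap_image_subset hEsub σ)
  have hself : ∀ i σ, f i ⁻¹' (wordMap f (i :: σ) '' E) = wordMap f σ '' E := by
    intro i σ
    rw [wordMap_cons, Set.image_comp, Set.preimage_image_eq _ (hinj i)]
  have hνσ : ∀ σ, ν (wordMap f σ '' E) = ENNReal.ofReal (prodw t σ) := by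
    intro σ
    induction σ with
    | nil => simpa using (prob_compl_eq_zero_iff hEcpt.measurableSet).1 hνE
    | cons i σ ih =>
      rw [selfSimilar_apply hfm hνss (hEm _), Finset.sum_eq_single i, hself, ih, prodw_cons,
        ENNReal.ofReal_mul (ht i).le]
      · intro j _ hj
        rw [hnull j i σ hj, mul_zero]
      · simp
  have hmain : ∀ σ : List (Fin N), μ (wordMap f σ '' E) = ENNReal.ofReal
      (∑ j ∈ Finset.range σ.length, p0 * prodw p (σ.take j) * prodw t (σ.drop j)
        + prodw p σ) := by
    intro σ
    induction σ with
    | nil => simpa using (prob_compl_eq_zero_iff hEcpt.measurableSet).1 (hac hνE)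
    | cons i σ ih =>
      rw [inhomSelfSimilar_apply hfm hμss (hEm _), hνσ, Finset.sum_eq_single i, hself, ih,
        ← ENNReal.ofReal_mul hp0.le, ← ENNReal.ofReal_mul (hp i).le, ← ENNReal.ofReal_add]
      · congr 1
        rw [List.length_cons, Finset.sum_range_succ']
        simp only [List.take_succ_cons, List.drop_succ_cons, List.take_zero, List.drop_zero,
          prodw_cons, prodw_nil, mul_add, Finset.mul_sum]
        ring_nf
      · exact mul_nonneg hp0.le (prodw_pos ht _).le
      · refine mul_nonneg (hp i).le (add_nonneg (Finset.sum_nonneg fun j _ => ?_)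
          (prodw_pos hp _).le)
        exact mul_nonneg (mul_nonneg hp0.le (prodw_pos hp _).le) (prodw_pos ht _).le
      · intro j _ hj
        rw [hac (hnull j i σ hj), mul_zero]
      · simp
  exact fun σ _ => hmain σ
end

section
/- Let J ⊆ ℝ^q be a nonempty compact set such that J = cl(int(J)), int(J) ∩ E ≠ ∅, f_i(J) ⊆ J for all 1 ≤ i ≤ N, and f_i(int(J)) ∩ f_j(int(J)) = ∅ for i ≠ j, and suppose ν(int(J)) = 1. Then μ(int(J)) = 1. -/
open MeasureTheory Filter

/-- A map of `ℝ^q` scaling all distances by a positive factor is an open map. -/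
theorem isOpenMap_of_dist_eq_mul {q : ℕ}
    {g : EuclideanSpace ℝ (Fin q) → EuclideanSpace ℝ (Fin q)} {c : ℝ} (hc : 0 < c)
    (hg : ∀ x y, dist (g x) (g y) = c * dist x y) : IsOpenMap g := by
  have hiso : Isometry fun x => c⁻¹ • g x := Isometry.of_dist_eq fun x y => by
    rw [dist_smul₀, hg, Real.norm_of_nonneg (by positivity), inv_mul_cancel_left₀ hc.ne']
  have hopen : IsOpenMap fun x => c⁻¹ • g x :=
    (hiso.affineIsometryOfStrictConvexSpace.toAffineIsometryEquiv rfl).toHomeomorph.isOpenMap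
  have hcomp : g = (fun x => c • x) ∘ fun x => c⁻¹ • g x := by
    ext1 x
    simp [smul_smul, hc.ne']
  rw [hcomp]
  exact (isOpenMap_smul₀ hc.ne').comp hopen

/-- An in-homogeneous self-similar probability measure gives full measure to every forward
invariant measurable set that has full measure for the condensation measure. -/
theorem measure_eq_one_of_mapsTo {X ι : Type*} [MeasurableSpace X] [Fintype ι]
    {μ ν : Measure X} [IsProbabilityMeasure μ] [IsProbabilityMeasure ν] {f : ι → X → X}
    (hf : ∀ i, Measurable (f i)) {p0 : ℝ} {p : ι → ℝ} (hp0 : 0 < p0) (hp : ∀ i, 0 ≤ p i)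
    (hp1 : p0 + ∑ i, p i = 1)
    (hμ : μ = ENNReal.ofReal p0 • ν + ∑ i, ENNReal.ofReal (p i) • μ.map (f i))
    {U : Set X} (hU : MeasurableSet U) (hmaps : ∀ i, Set.MapsTo (f i) U U) (hν : ν U = 1) :
    μ U = 1 := by
  have hsum : μ U = ENNReal.ofReal p0 + ∑ i, ENNReal.ofReal (p i) * μ (f i ⁻¹' U) := by
    conv_lhs => rw [hμ]
    simp [Measure.map_apply (hf _) hU, hν]
  have hle : ENNReal.ofReal p0 + (∑ i, ENNReal.ofReal (p i)) * μ U ≤ μ U := by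
    conv_rhs => rw [hsum]
    rw [Finset.sum_mul]
    gcongr with i
    exact hmaps i
  rw [← ENNReal.ofReal_sum_of_nonneg fun i _ => hp i, ← ofReal_measureReal,
    ← ENNReal.ofReal_mul (Finset.sum_nonneg fun i _ => hp i),
    ← ENNReal.ofReal_add hp0.le (mul_nonneg (Finset.sum_nonneg fun i _ => hp i)
      measureReal_nonneg), ENNReal.ofReal_le_ofReal_iff measureReal_nonneg,
    eq_sub_of_add_eq' hp1] at hle
  have hone : 1 ≤ μ.real U := by nlinarith
  refine le_antisymm prob_le_one ?_
  rw [← ofReal_measureReal]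
  exact ENNReal.one_le_ofReal.2 hone

/-- If `J` is a nonempty compact set with `J = cl(int J)`, `int J ∩ E ≠ ∅`,
`f_i(J) ⊆ J`, pairwise disjoint `f_i(int J)`, and `ν(int J) = 1`, then `μ(int J) = 1`. -/
theorem measure_interior_eq_one
    (q N : ℕ) (hq : 1 ≤ q) (hN : 2 ≤ N) (r : ℝ) (hr : 0 < r)
    (f : Fin N → EuclideanSpace ℝ (Fin q) → EuclideanSpace ℝ (Fin q))
    (s : Fin N → ℝ) (hs : ∀ i, s i ∈ Set.Ioo (0 : ℝ) 1)
    (hf : ∀ i x y, dist (f i x) (f i y) = s i * dist x y)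
    (E : Set (EuclideanSpace ℝ (Fin q)))
    (hEcpt : IsCompact E) (hEne : E.Nonempty) (hEss : E = ⋃ i, f i '' E)
    (hEdiam : Metric.diam E = 1)
    (t : Fin N → ℝ) (ht : ∀ i, 0 < t i) (ht1 : ∑ i, t i = 1)
    (ν : Measure (EuclideanSpace ℝ (Fin q))) (hνP : IsProbabilityMeasure ν)
    (hνc : ∃ K, IsCompact K ∧ ν Kᶜ = 0)
    (hνss : ν = ∑ i, ENNReal.ofReal (t i) • ν.map (f i))
    (p0 : ℝ) (p : Fin N → ℝ) (hp0 : 0 < p0) (hp : ∀ i, 0 < p i)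
    (hp1 : p0 + ∑ i, p i = 1)
    (μ : Measure (EuclideanSpace ℝ (Fin q))) (hμP : IsProbabilityMeasure μ)
    (hμc : ∃ K, IsCompact K ∧ μ Kᶜ = 0)
    (hμss : μ = ENNReal.ofReal p0 • ν + ∑ i, ENNReal.ofReal (p i) • μ.map (f i))
    :
    ∀ J : Set (EuclideanSpace ℝ (Fin q)), J.Nonempty → IsCompact J →
      J = closure (interior J) → (interior J ∩ E).Nonempty →
      (∀ i, f i '' J ⊆ J) →
      (Pairwise fun i j => Disjoint (f i '' interior J) (f j '' interior J)) →
      ν (interior J) = 1 → μ (interior J) = 1 := by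
  intro J _ _ _ _ hmaps _ hνJ
  have hcont (i : Fin N) : Continuous (f i) :=
    (LipschitzWith.of_dist_le_mul (K := ⟨s i, (hs i).1.le⟩) fun x y => (hf i x y).le).continuous
  refine measure_eq_one_of_mapsTo (fun i => (hcont i).measurable) hp0 (fun i => (hp i).le) hp1 hμss
    isOpen_interior.measurableSet (fun i => Set.mapsTo_iff_image_subset.2 ?_) hνJ
  exact interior_maximal ((Set.image_mono interior_subset).trans (hmaps i))
    (isOpenMap_of_dist_eq_mul (hs i).1 (hf i) _ isOpen_interior)
end
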